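/- Let n be a natural number, let X be a locally compact Hausdorff subset of ℝⁿ (with the subspace topology), and let 𝒜 be a subalgebra of C(X, ℝ) containing the constant function 1. Let L : 𝒜 → ℝ be a linear functional satisfying L(a) ≥ 0 for every a ∈ 𝒜 with a(x) ≥ 0 for all x ∈ X. Then there exist a linear functional L' on C'(X) := { f ∈ C(X, ℝ) : ∃ a ∈ 𝒜, |f| ≤ |a| pointwise } extending L and positive (L'(f) ≥ 0 whenever f ≥ 0 pointwise), and a Borel measure μ on X such that L'(f) = ∫_X f dμ for every continuous f : X → ℝ with compact support. -/

import Mathlib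

set_option synthInstance.maxHeartbeats 400000
set_option maxHeartbeats 800000

open scoped CompactlySupported

/-- The continuous functions dominated in absolute value by an element of the subalgebra `𝒜`. -/
def Subalgebra.dominated {X : Type*} [TopologicalSpace X] (𝒜 : Subalgebra ℝ C(X, ℝ)) :
    Submodule ℝ C(X, ℝ) where
  carrier := {f | ∃ a ∈ 𝒜, ∀ x, |f x| ≤ |a x|}
  zero_mem' := ⟨0, 𝒜.zero_mem, by simp⟩
  add_mem' := by
    rintro f g ⟨a, ha, hfa⟩ ⟨b, hb, hgb⟩
    refine ⟨a * a + b * b + 1,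
      𝒜.add_mem (𝒜.add_mem (𝒜.mul_mem ha ha) (𝒜.mul_mem hb hb)) 𝒜.one_mem, fun x ↦ ?_⟩
    have h : |f x + g x| ≤ |f x| + |g x| := abs_add_le _ _
    have h' : a x * a x + b x * b x + 1 ≤ |a x * a x + b x * b x + 1| := le_abs_self _
    simp only [ContinuousMap.add_apply, ContinuousMap.mul_apply, ContinuousMap.one_apply]
    nlinarith [hfa x, hgb x, abs_mul_abs_self (a x), abs_mul_abs_self (b x),
      sq_nonneg (|a x| - 1 / 2), sq_nonneg (|b x| - 1 / 2)]
  smul_mem' := by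
    rintro c f ⟨a, ha, hfa⟩
    refine ⟨c • a, 𝒜.smul_mem ha c, fun x ↦ ?_⟩
    simpa [abs_mul] using mul_le_mul_of_nonneg_left (hfa x) (abs_nonneg c)

namespace Subalgebra

variable {X : Type*} [TopologicalSpace X] (𝒜 : Subalgebra ℝ C(X, ℝ))

theorem toSubmodule_le_dominated : Subalgebra.toSubmodule 𝒜 ≤ 𝒜.dominated :=
  fun a ha ↦ ⟨a, ha, fun _ ↦ le_rfl⟩

theorem mem_dominated_of_hasCompactSupport {f : C(X, ℝ)} (hf : HasCompactSupport f) :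
    f ∈ 𝒜.dominated := by
  obtain ⟨C, hC⟩ := hf.exists_bound_of_continuous f.continuous
  refine ⟨algebraMap ℝ _ C, 𝒜.algebraMap_mem C, fun x ↦ ?_⟩
  simpa using (hC x).trans (le_abs_self C)

/-- A positive linear functional on a subalgebra of `C(X, ℝ)` extends to a positive linear
functional on the space of continuous functions dominated by the subalgebra. -/
theorem exists_nonneg_extension_dominated (L : 𝒜 →ₗ[ℝ] ℝ)
    (hL : ∀ a : 𝒜, (∀ x : X, 0 ≤ (a : C(X, ℝ)) x) → 0 ≤ L a) :
    ∃ g : 𝒜.dominated →ₗ[ℝ] ℝ,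
      (∀ a : 𝒜, g ⟨a, 𝒜.toSubmodule_le_dominated a.2⟩ = L a) ∧
      ∀ f : 𝒜.dominated, (∀ x, 0 ≤ (f : C(X, ℝ)) x) → 0 ≤ g f := by
  let s : PointedCone ℝ 𝒜.dominated :=
    { carrier := {f | ∀ x, 0 ≤ (f : C(X, ℝ)) x}
      zero_mem' := fun x ↦ le_rfl
      add_mem' := fun hf hg x ↦ add_nonneg (hf x) (hg x)
      smul_mem' := fun c f hf x ↦ mul_nonneg c.2 (hf x) }
  let p : 𝒜.dominated →ₗ.[ℝ] ℝ :=
    { domain := (Subalgebra.toSubmodule 𝒜).comap 𝒜.dominated.subtype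
      toFun := L.comp ((𝒜.dominated.subtype.comp (Submodule.subtype _)).codRestrict
        (Subalgebra.toSubmodule 𝒜) fun a ↦ a.2) }
  obtain ⟨g, hgp, hgs⟩ := riesz_extension s p (fun a ha ↦ hL ⟨a, a.2⟩ ha) (by
    rintro ⟨f, a, ha, hfa⟩
    have hb : a * a + 1 ∈ 𝒜 := 𝒜.add_mem (𝒜.mul_mem ha ha) 𝒜.one_mem
    refine ⟨⟨⟨a * a + 1, 𝒜.toSubmodule_le_dominated hb⟩, hb⟩, fun x ↦ ?_⟩
    change 0 ≤ a x * a x + 1 + f x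
    nlinarith [hfa x, neg_abs_le (f x), abs_mul_abs_self (a x), sq_nonneg (|a x| - 1 / 2)])
  exact ⟨g, fun a ↦ hgp ⟨⟨a, 𝒜.toSubmodule_le_dominated a.2⟩, a.2⟩, hgs⟩

/-- A positive linear functional on the functions dominated by a subalgebra is given by a measure
on the compactly supported functions. -/
theorem exists_measure_eq_integral [T2Space X] [LocallyCompactSpace X] [MeasurableSpace X]
    [BorelSpace X] (g : 𝒜.dominated →ₗ[ℝ] ℝ)
    (hg : ∀ f : 𝒜.dominated, (∀ x, 0 ≤ (f : C(X, ℝ)) x) → 0 ≤ g f) :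
    ∃ μ : MeasureTheory.Measure X, ∀ (f : C(X, ℝ)) (hf : HasCompactSupport f),
      g ⟨f, 𝒜.mem_dominated_of_hasCompactSupport hf⟩ = ∫ x, f x ∂μ := by
  let Λ : C_c(X, ℝ) →ₗ[ℝ] ℝ :=
    { toFun := fun f ↦
        g ⟨f.toContinuousMap, 𝒜.mem_dominated_of_hasCompactSupport f.hasCompactSupport⟩
      map_add' := fun f h ↦ g.map_add
        ⟨f.toContinuousMap, 𝒜.mem_dominated_of_hasCompactSupport f.hasCompactSupport⟩
        ⟨h.toContinuousMap, 𝒜.mem_dominated_of_hasCompactSupport h.hasCompactSupport⟩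
      map_smul' := fun c f ↦ g.map_smul c
        ⟨f.toContinuousMap, 𝒜.mem_dominated_of_hasCompactSupport f.hasCompactSupport⟩ }
  let Λ' : C_c(X, ℝ) →ₚ[ℝ] ℝ := .mk₀ Λ fun f hf ↦ hg _ hf
  exact ⟨RealRMK.rieszMeasure Λ', fun f hf ↦ (RealRMK.integral_rieszMeasure Λ' ⟨f, hf⟩).symm⟩

end Subalgebra

/-- Let `X ⊆ ℝⁿ` be locally compact (it is automatically Hausdorff),
`𝒜` a subalgebra of `C(X, ℝ)` containing `1`, and `L : 𝒜 → ℝ` a positive linear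
functional. Then there are a positive linear functional `L'` on
`C'(X) = {f : ∃ a ∈ 𝒜, |f| ≤ |a|}` extending `L`, and a Borel measure `μ` on `X`,
such that `L' f = ∫ f dμ` for every continuous `f` with compact support. -/
theorem stmt_6 (n : ℕ) (X : Set (EuclideanSpace ℝ (Fin n)))
    (hX : LocallyCompactSpace X)
    (𝒜 : Subalgebra ℝ C(X, ℝ)) (L : 𝒜 →ₗ[ℝ] ℝ)
    (hL : ∀ a : 𝒜, (∀ x : X, 0 ≤ (a : C(X, ℝ)) x) → 0 ≤ L a) :
    let C' : Set C(X, ℝ) := {f | ∃ a ∈ 𝒜, ∀ x : X, |f x| ≤ |a x|}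
    ∃ (L' : C(X, ℝ) → ℝ) (μ : MeasureTheory.Measure X),
      (∀ f ∈ C', ∀ g ∈ C', L' (f + g) = L' f + L' g) ∧
      (∀ (c : ℝ), ∀ f ∈ C', L' (c • f) = c * L' f) ∧
      (∀ a : 𝒜, L' (a : C(X, ℝ)) = L a) ∧
      (∀ f ∈ C', (∀ x : X, 0 ≤ f x) → 0 ≤ L' f) ∧
      (∀ f : C(X, ℝ), HasCompactSupport f → L' f = ∫ x, f x ∂μ) := by
  classical
  intro C'
  obtain ⟨g, hgL, hg⟩ := 𝒜.exists_nonneg_extension_dominated L hL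
  obtain ⟨μ, hμ⟩ := 𝒜.exists_measure_eq_integral g hg
  let L' : C(X, ℝ) → ℝ := fun f ↦ if h : f ∈ 𝒜.dominated then g ⟨f, h⟩ else 0
  have hL' (f : C(X, ℝ)) (h : f ∈ 𝒜.dominated) : L' f = g ⟨f, h⟩ := dif_pos h
  refine ⟨L', μ, fun f hf h hh ↦ ?_, fun c f hf ↦ ?_, fun a ↦ ?_, fun f hf hpos ↦ ?_,
    fun f hf ↦ ?_⟩
  · rw [hL' f hf, hL' h hh, hL' _ (𝒜.dominated.add_mem hf hh), ← g.map_add]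
    rfl
  · rw [hL' f hf, hL' _ (𝒜.dominated.smul_mem c hf), ← smul_eq_mul, ← g.map_smul]
    rfl
  · rw [hL' _ (𝒜.toSubmodule_le_dominated a.2), hgL]
  · rw [hL' f hf]
    exact hg _ hpos
  · rw [hL' f (𝒜.mem_dominated_of_hasCompactSupport hf), hμ f hf]
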